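/- Let α > 0, b > 0, J = [0,b]. Let ϑ, η : J → ℝ be integrable and nonnegative with η nondecreasing, let ρ : J → ℝ be continuous, nonnegative and nondecreasing, and let ψ : J → ℝ be continuous, increasing, and differentiable with ψ'(z) ≠ 0 for z ∈ J. If for all z ∈ J, ϑ(z) ≤ η(z) + ρ(z) ∫₀^z ψ'(κ)(ψ(z) − ψ(κ))^{α−1} ϑ(κ) dκ, then for all z ∈ J, ϑ(z) ≤ η(z) · E_α(ρ(z) Γ(α) (ψ(z) − ψ(0))^α), where E_α is the Mittag-Leffler function. -/

import Mathlib

open MeasureTheory Set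

/-- ψ-Riemann–Liouville fractional integral of order `α` of `f` with respect to `ψ`
(with `ψ'` a given derivative function of `ψ`):
`I^{α,ψ} f (z) = (1/Γ(α)) ∫₀^z ψ'(κ) (ψ(z) - ψ(κ))^(α-1) f(κ) dκ`. -/
noncomputable def psiInt (α : ℝ) (ψ ψ' f : ℝ → ℝ) (z : ℝ) : ℝ :=
  (1 / Real.Gamma α) * ∫ κ in (0:ℝ)..z, ψ' κ * (ψ z - ψ κ) ^ (α - 1) * f κ

/-- ψ-Caputo fractional derivative of order `α` (for `0 < α < 1`) of a function with
derivative `v'`, with respect to `ψ` (with derivative `ψ'`):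
`N^{α,ψ} v (z) = (1/Γ(1-α)) ∫₀^z ψ'(κ) (ψ(z) - ψ(κ))^(-α) (v'(κ)/ψ'(κ)) dκ`. -/
noncomputable def psiCaputo (α : ℝ) (ψ ψ' v' : ℝ → ℝ) (z : ℝ) : ℝ :=
  (1 / Real.Gamma (1 - α)) * ∫ κ in (0:ℝ)..z, ψ' κ * (ψ z - ψ κ) ^ (-α) * (v' κ / ψ' κ)

/-- Mittag-Leffler function `E_α(x) = ∑_{m=0}^∞ x^m / Γ(α m + 1)`. -/
noncomputable def mittagLeffler (α x : ℝ) : ℝ :=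
  ∑' m : ℕ, x ^ m / Real.Gamma (α * m + 1)

/-- The Beta integral over `(0, s)`, as a Lebesgue integral. -/
lemma lintegral_rpow_mul_sub_rpow {α β s : ℝ} (hα : 0 < α) (hβ : 0 < β) (hs : 0 < s) :
    ∫⁻ t in Ioo 0 s, ENNReal.ofReal (t ^ (β - 1) * (s - t) ^ (α - 1)) =
      ENNReal.ofReal (ProbabilityTheory.beta β α * s ^ (α + β - 1)) := by
  have hB := ProbabilityTheory.beta_pos hβ hα
  have himg : (fun x => s * x) '' Ioo 0 1 = Ioo 0 s := by
    simp [image_mul_left_Ioo hs]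
  rw [← himg, lintegral_image_eq_lintegral_abs_deriv_mul (f' := fun _ => s) measurableSet_Ioo
    (fun x _ => by simpa using ((hasDerivAt_id x).const_mul s).hasDerivWithinAt)
    (mul_right_injective₀ hs.ne').injOn]
  have hpt : ∀ x ∈ Ioo (0 : ℝ) 1, ENNReal.ofReal |s| *
      ENNReal.ofReal ((s * x) ^ (β - 1) * (s - s * x) ^ (α - 1)) =
      ENNReal.ofReal (ProbabilityTheory.beta β α * s ^ (α + β - 1)) *
        ENNReal.ofReal (1 / ProbabilityTheory.beta β α * x ^ (β - 1) * (1 - x) ^ (α - 1)) := by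
    intro x hx
    rw [← ENNReal.ofReal_mul (abs_nonneg s), ← ENNReal.ofReal_mul (by positivity), abs_of_pos hs]
    congr 1
    rw [show s - s * x = s * (1 - x) by ring, Real.mul_rpow hs.le hx.1.le,
      Real.mul_rpow hs.le (by linarith [hx.2]),
      show α + β - 1 = 1 + (β - 1) + (α - 1) by ring, Real.rpow_add hs, Real.rpow_add hs,
      Real.rpow_one]
    field_simp
  rw [setLIntegral_congr_fun measurableSet_Ioo hpt, lintegral_const_mul _ (by fun_prop),
    ← ProbabilityTheory.lintegral_betaPDF, ProbabilityTheory.lintegral_betaPDF_eq_one hβ hα, mul_one]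

lemma lintegral_rpow_mul_exp_neg_mul_Ioi {α l : ℝ} (hα : 0 < α) (hl : 0 < l) :
    ∫⁻ x in Ioi 0, ENNReal.ofReal (x ^ (α - 1) * Real.exp (-(l * x))) =
      ENNReal.ofReal ((1 / l) ^ α * Real.Gamma α) := by
  have h := Real.integral_rpow_mul_exp_neg_mul_Ioi hα hl
  rw [← h, ofReal_integral_eq_lintegral_ofReal]
  · apply Integrable.of_integral_ne_zero
    rw [h]
    have := Real.Gamma_pos_of_pos hα
    positivity
  · filter_upwards [ae_restrict_mem measurableSet_Ioi] with x hx
    have : 0 < x := hx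
    positivity

/-- An integrable function dominated by a multiple of its fractional integral vanishes a.e. -/
lemma lintegral_eq_zero_of_le_fractionalIntegral {α r y : ℝ} (hα : 0 < α) (hr : 0 ≤ r)
    {u : ℝ → ENNReal} (hu : AEMeasurable u (volume.restrict (Ioo 0 y)))
    (hfin : ∫⁻ t in Ioo 0 y, u t ≠ ⊤)
    (h : ∀ s ∈ Ioo 0 y, u s ≤ ENNReal.ofReal r *
      ∫⁻ t in Ioo 0 s, ENNReal.ofReal ((s - t) ^ (α - 1)) * u t) :
    ∫⁻ t in Ioo 0 y, u t = 0 := by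
  have hΓ := Real.Gamma_pos_of_pos hα
  obtain ⟨l, hl, hlr⟩ : ∃ l : ℝ, 0 < l ∧ r * ((1 / l) ^ α * Real.Gamma α) ≤ 1 / 2 := by
    have hc : 0 < 2 * r * Real.Gamma α + 1 := by positivity
    refine ⟨(2 * r * Real.Gamma α + 1) ^ (1 / α), by positivity, ?_⟩
    rw [Real.div_rpow zero_le_one (by positivity), Real.one_rpow, ← Real.rpow_mul hc.le,
      one_div_mul_cancel hα.ne', Real.rpow_one]
    field_simp
    linarith
  set μ := volume.restrict (Ioo (0 : ℝ) y) with hμ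
  let e : ℝ → ENNReal := fun s => ENNReal.ofReal (Real.exp (-(l * s)))
  let k : ℝ → ENNReal := (Ioi 0).indicator fun x => ENNReal.ofReal (x ^ (α - 1))
  have he : Measurable e := by fun_prop
  have hk : Measurable k := Measurable.indicator (by fun_prop) measurableSet_Ioi
  have hkle : ∀ s ∈ Ioo 0 y, u s ≤ ENNReal.ofReal r * ∫⁻ t, k (s - t) * u t ∂μ := by
    intro s hs
    refine (h s hs).trans ?_
    gcongr ENNReal.ofReal r * ?_
    rw [setLIntegral_congr_fun (g := fun t => k (s - t) * u t) measurableSet_Ioo]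
    · exact lintegral_mono_set (Ioo_subset_Ioo_right hs.2.le)
    · intro t ht
      simp [k, ht.2]
  have hinner : ∀ t, ∫⁻ s, e s * k (s - t) ∂μ ≤
      e t * ENNReal.ofReal ((1 / l) ^ α * Real.Gamma α) := by
    intro t
    calc ∫⁻ s, e s * k (s - t) ∂μ ≤ ∫⁻ s, e s * k (s - t) := setLIntegral_le_lintegral _ _
      _ = ∫⁻ x, e (x + t) * k x := by
        rw [← lintegral_add_right_eq_self _ t]; simp
      _ = ∫⁻ x, (Ioi 0).indicator
            (fun x => e t * ENNReal.ofReal (x ^ (α - 1) * Real.exp (-(l * x)))) x := by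
        congr 1 with x
        by_cases hx : x ∈ Ioi (0 : ℝ)
        · have hx0 : 0 ≤ x := le_of_lt hx
          simp only [k, e, indicator_of_mem hx]
          rw [← ENNReal.ofReal_mul (by positivity), ← ENNReal.ofReal_mul (by positivity),
            show -(l * (x + t)) = -(l * t) + -(l * x) by ring, Real.exp_add]
          ring_nf
        · simp [k, indicator_of_notMem hx]
      _ = _ := by
        rw [lintegral_indicator measurableSet_Ioi, lintegral_const_mul _ (by fun_prop),
          lintegral_rpow_mul_exp_neg_mul_Ioi hα hl]
  set I := ∫⁻ s, e s * u s ∂μ with hI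
  have hIle : I ≤ ENNReal.ofReal (1 / 2) * I := by
    calc I ≤ ∫⁻ s, e s * (ENNReal.ofReal r * ∫⁻ t, k (s - t) * u t ∂μ) ∂μ := by
          apply setLIntegral_mono_ae' measurableSet_Ioo
          filter_upwards with s hs
          gcongr
          exact hkle s hs
      _ = ENNReal.ofReal r * ∫⁻ s, ∫⁻ t, e s * (k (s - t) * u t) ∂μ ∂μ := by
          rw [← lintegral_const_mul' _ _ ENNReal.ofReal_ne_top]
          congr 1 with s
          rw [lintegral_const_mul' _ _ ENNReal.ofReal_ne_top]
          ring
      _ = ENNReal.ofReal r * ∫⁻ t, ∫⁻ s, e s * (k (s - t) * u t) ∂μ ∂μ := by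
          rw [lintegral_lintegral_swap]
          refine (he.comp measurable_fst).aemeasurable.mul
            ((hk.comp (measurable_fst.sub measurable_snd)).aemeasurable.mul hu.comp_snd)
      _ = ENNReal.ofReal r * ∫⁻ t, (∫⁻ s, e s * k (s - t) ∂μ) * u t ∂μ := by
          congr 2 with t
          simp_rw [← mul_assoc]
          rw [lintegral_mul_const]
          fun_prop
      _ ≤ ENNReal.ofReal r * ∫⁻ t, (e t * ENNReal.ofReal ((1 / l) ^ α * Real.Gamma α)) * u t ∂μ := by
          gcongr with t
          exact hinner t
      _ = ENNReal.ofReal (r * ((1 / l) ^ α * Real.Gamma α)) * I := by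
          rw [ENNReal.ofReal_mul hr, mul_assoc, hI,
            ← lintegral_const_mul' (ENNReal.ofReal ((1 / l) ^ α * Real.Gamma α)) _
              ENNReal.ofReal_ne_top]
          congr 1
          exact lintegral_congr fun t => by ring
      _ ≤ _ := by gcongr
  have hIfin : I ≠ ⊤ := by
    refine ne_top_of_le_ne_top hfin (setLIntegral_mono_ae' measurableSet_Ioo ?_)
    filter_upwards with s hs
    refine mul_le_of_le_one_left' (ENNReal.ofReal_le_one.2 (Real.exp_le_one_iff.2 ?_))
    have := mul_pos hl hs.1
    linarith
  have hI0 : I = 0 := by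
    have h2 : I.toReal ≤ 1 / 2 * I.toReal := by
      simpa using ENNReal.toReal_mono (ENNReal.mul_ne_top ENNReal.ofReal_ne_top hIfin) hIle
    have : I.toReal = 0 := le_antisymm (by linarith) ENNReal.toReal_nonneg
    exact (ENNReal.toReal_eq_zero_iff _).1 this |>.resolve_right hIfin
  rw [hI, lintegral_eq_zero_iff' (f := fun s => e s * u s) (he.aemeasurable.mul hu)] at hI0
  rw [lintegral_eq_zero_iff' hu]
  filter_upwards [hI0] with s hs
  simpa [e, (Real.exp_pos _).not_ge] using hs

lemma rpow_mul_exp_neg_le_Gamma {s l : ℝ} (hs : 0 ≤ s) (hl : 0 ≤ l) :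
    l ^ s * Real.exp (-l) ≤ Real.Gamma (s + 1) := by
  have hint := Real.GammaIntegral_convergent (show 0 < s + 1 by linarith)
  rw [Real.Gamma_eq_integral (by linarith), ← integral_exp_neg_Ioi, ← integral_const_mul]
  calc _ ≤ ∫ x in Ioi l, Real.exp (-x) * x ^ (s + 1 - 1) := by
        refine setIntegral_mono_on ((integrableOn_exp_neg_Ioi l).const_mul _)
          (hint.mono_set (Ioi_subset_Ioi hl)) measurableSet_Ioi fun x hx => ?_
        have : l < x := hx
        rw [add_sub_cancel_right, mul_comm]
        gcongr
    _ ≤ _ := by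
        refine setIntegral_mono_set hint ?_ (Ioi_subset_Ioi hl).eventuallyLE
        filter_upwards [ae_restrict_mem measurableSet_Ioi] with x hx
        have : 0 < x := hx
        positivity

lemma summable_mittagLeffler {α x : ℝ} (hα : 0 < α) (hx : 0 ≤ x) :
    Summable fun m : ℕ => x ^ m / Real.Gamma (α * m + 1) := by
  obtain ⟨l, hl, hlx⟩ : ∃ l : ℝ, 0 < l ∧ x < l ^ α := by
    refine ⟨(x + 1) ^ (1 / α), by positivity, ?_⟩
    rw [← Real.rpow_mul (by positivity), one_div_mul_cancel hα.ne', Real.rpow_one]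
    linarith
  have hpos : 0 < l ^ α := by positivity
  refine Summable.of_nonneg_of_le
    (fun m => div_nonneg (by positivity) (Real.Gamma_nonneg_of_nonneg (by positivity))) (fun m => ?_)
    ((summable_geometric_of_lt_one (r := x / l ^ α) (by positivity)
      ((div_lt_one hpos).2 hlx)).mul_left (Real.exp l))
  have h := rpow_mul_exp_neg_le_Gamma (s := α * m) (by positivity) hl.le
  calc x ^ m / Real.Gamma (α * m + 1) ≤ x ^ m / (l ^ (α * m) * Real.exp (-l)) := by gcongr
    _ = _ := by
      rw [Real.rpow_mul_natCast hl.le, Real.exp_neg, div_pow]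
      field_simp

/-- Gronwall inequality for the fractional integral with constant coefficients, in `ℝ≥0∞`. -/
lemma fractional_gronwall_lintegral {α a r s₀ : ℝ} (hα : 0 < α) (ha : 0 ≤ a) (hr : 0 ≤ r)
    (hs₀ : 0 < s₀) {U : ℝ → ENNReal} (hU : AEMeasurable U (volume.restrict (Ioo 0 s₀)))
    (hfin : ∫⁻ t in Ioo 0 s₀, ENNReal.ofReal ((s₀ - t) ^ (α - 1)) * U t ≠ ⊤)
    (h : ∀ s ∈ Ioc 0 s₀, U s ≤ ENNReal.ofReal a + ENNReal.ofReal r *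
      ∫⁻ t in Ioo 0 s, ENNReal.ofReal ((s - t) ^ (α - 1)) * U t) :
    U s₀ ≤ ∑' m : ℕ, ENNReal.ofReal
      (a * ((r * Real.Gamma α) ^ m * s₀ ^ (α * m) / Real.Gamma (α * m + 1))) := by
  have hΓ := Real.Gamma_pos_of_pos hα
  have hΓm : ∀ m : ℕ, 0 < Real.Gamma (α * m + 1) := fun m => Real.Gamma_pos_of_pos (by positivity)
  let w : ℕ → ℝ → ENNReal := fun m s => ENNReal.ofReal
      (a * ((r * Real.Gamma α) ^ m * s ^ (α * m) / Real.Gamma (α * m + 1)))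
  let W : ℝ → ENNReal := fun s => ∑' m, w m s
  have hw : ∀ m, Measurable (w m) := fun m => by fun_prop
  have hW : Measurable W := Measurable.tsum hw
  have hstep : ∀ m : ℕ, ∀ s, 0 < s → ENNReal.ofReal r *
      ∫⁻ t in Ioo 0 s, ENNReal.ofReal ((s - t) ^ (α - 1)) * w m t = w (m + 1) s := by
    intro m s hs
    have hβ : 0 < α * m + 1 := by positivity
    have hc : 0 ≤ a * ((r * Real.Gamma α) ^ m / Real.Gamma (α * m + 1)) :=
      mul_nonneg ha (div_nonneg (by positivity) (hΓm m).le)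
    rw [setLIntegral_congr_fun (g := fun t =>
      ENNReal.ofReal (a * ((r * Real.Gamma α) ^ m / Real.Gamma (α * m + 1))) *
        ENNReal.ofReal (t ^ (α * m + 1 - 1) * (s - t) ^ (α - 1))) measurableSet_Ioo,
      lintegral_const_mul _ (by fun_prop), lintegral_rpow_mul_sub_rpow hα hβ hs,
      ← ENNReal.ofReal_mul hc, ← ENNReal.ofReal_mul hr]
    · simp only [w, ProbabilityTheory.beta]
      have h1 := (hΓm m).ne'
      have h2 := (hΓm (m + 1)).ne'
      congr 1
      push_cast at h2 ⊢
      rw [show α * m + 1 + α = α * (m + 1) + 1 by ring,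
        show α + (α * m + 1) - 1 = α * (m + 1) by ring]
      field_simp
      ring
    · intro t ht
      have : 0 ≤ s - t := by linarith [ht.2]
      simp only [w]
      rw [← ENNReal.ofReal_mul (by positivity), ← ENNReal.ofReal_mul hc, add_sub_cancel_right]
      congr 1
      ring
  have hWeq : ∀ s, 0 < s → ENNReal.ofReal a + ENNReal.ofReal r *
      ∫⁻ t in Ioo 0 s, ENNReal.ofReal ((s - t) ^ (α - 1)) * W t = W s := by
    intro s hs
    simp only [W]
    rw [tsum_eq_zero_add' ENNReal.summable]
    congr 1
    · simp [w]
    · simp_rw [← ENNReal.tsum_mul_left]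
      rw [lintegral_tsum fun m => by fun_prop, ← ENNReal.tsum_mul_left]
      exact tsum_congr fun m => hstep m s hs
  let u : ℝ → ENNReal := fun s => U s - W s
  have hu : AEMeasurable u (volume.restrict (Ioo 0 s₀)) := hU.sub hW.aemeasurable
  have hule : ∀ s ∈ Ioc 0 s₀, u s ≤ ENNReal.ofReal r *
      ∫⁻ t in Ioo 0 s, ENNReal.ofReal ((s - t) ^ (α - 1)) * u t := by
    intro s hs
    refine tsub_le_iff_left.2 ((h s hs).trans ?_)
    rw [← hWeq s hs.1, add_assoc, ← mul_add, ← lintegral_add_left (by fun_prop)]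
    gcongr with t
    rw [← mul_add]
    gcongr
    exact le_add_tsub
  have hzero : ∀ y < s₀, ∫⁻ t in Ioo 0 y, u t = 0 := by
    intro y hy
    rcases le_or_gt y 0 with hy0 | hy0
    · simp [Ioo_eq_empty_of_le hy0]
    refine lintegral_eq_zero_of_le_fractionalIntegral hα hr
      (hu.mono_set (Ioo_subset_Ioo_right hy.le)) ?_
      fun s hs => hule s ⟨hs.1, hs.2.le.trans hy.le⟩
    obtain ⟨c, hc, hck⟩ : ∃ c : ℝ, 0 < c ∧ ∀ t ∈ Ioo 0 y, c ≤ (s₀ - t) ^ (α - 1) := by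
      have hsy : 0 < s₀ - y := by linarith
      rcases le_total 1 α with h1 | h1
      · refine ⟨(s₀ - y) ^ (α - 1), by positivity, fun t ht => ?_⟩
        exact Real.rpow_le_rpow hsy.le (by linarith [ht.2]) (by linarith)
      · refine ⟨s₀ ^ (α - 1), by positivity, fun t ht => ?_⟩
        exact Real.rpow_le_rpow_of_nonpos (by linarith [ht.2]) (by linarith [ht.1]) (by linarith)
    have hle : ENNReal.ofReal c * ∫⁻ t in Ioo 0 y, u t ≤
        ∫⁻ t in Ioo 0 s₀, ENNReal.ofReal ((s₀ - t) ^ (α - 1)) * U t := by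
      rw [← lintegral_const_mul' _ _ ENNReal.ofReal_ne_top]
      refine le_trans (setLIntegral_mono_ae' measurableSet_Ioo ?_)
        (lintegral_mono_set (Ioo_subset_Ioo_right hy.le))
      filter_upwards with t ht
      gcongr
      · exact hck t ht
      · exact tsub_le_self
    intro htop
    rw [htop, ENNReal.mul_top (by simpa using hc)] at hle
    exact hfin (top_le_iff.1 hle)
  have hcover : Ioo 0 s₀ ⊆ ⋃ n : ℕ, Ioo 0 (s₀ - 1 / ((n : ℝ) + 1)) := by
    intro t ht
    obtain ⟨n, hn⟩ := exists_nat_one_div_lt (sub_pos.2 ht.2)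
    exact mem_iUnion.2 ⟨n, ht.1, by linarith⟩
  have hK : ∫⁻ t in Ioo 0 s₀, ENNReal.ofReal ((s₀ - t) ^ (α - 1)) * u t = 0 := by
    refine le_antisymm ((lintegral_mono_set hcover).trans ((lintegral_iUnion_le _ _).trans ?_))
      zero_le
    refine (ENNReal.tsum_eq_zero.2 fun n => ?_).le
    have hlt : s₀ - 1 / ((n : ℝ) + 1) < s₀ := sub_lt_self _ (by positivity)
    have h0 := hzero _ hlt
    rw [lintegral_eq_zero_iff' (hu.mono_set (Ioo_subset_Ioo_right hlt.le))] at h0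
    refine lintegral_eq_zero_of_ae_eq_zero ?_
    filter_upwards [h0] with t ht
    simp [ht]
  have hfinal := hule s₀ ⟨hs₀, le_rfl⟩
  rw [hK, mul_zero] at hfinal
  exact tsub_eq_zero_iff_le.1 (le_zero_iff.1 hfinal)

lemma one_le_mittagLeffler {α x : ℝ} (hα : 0 < α) (hx : 0 ≤ x) : 1 ≤ mittagLeffler α x := by
  have h := (summable_mittagLeffler hα hx).le_tsum 0 fun m _ =>
    div_nonneg (by positivity) (Real.Gamma_nonneg_of_nonneg (by positivity))
  simpa [mittagLeffler] using h

/-- Gronwall inequality for the fractional integral with constant coefficients. -/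
lemma fractional_gronwall {α a r s₀ : ℝ} (hα : 0 < α) (ha : 0 ≤ a) (hr : 0 ≤ r)
    (hs₀ : 0 ≤ s₀) {V : ℝ → ℝ} (hV : ∀ s ∈ Icc 0 s₀, 0 ≤ V s)
    (h : ∀ s ∈ Icc 0 s₀, V s ≤ a + r * ∫ t in Ioo 0 s, (s - t) ^ (α - 1) * V t) :
    V s₀ ≤ a * mittagLeffler α (r * Real.Gamma α * s₀ ^ α) := by
  have hΓ := Real.Gamma_pos_of_pos hα
  have hx : 0 ≤ r * Real.Gamma α * s₀ ^ α := by positivity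
  have hE := one_le_mittagLeffler hα hx
  have hs₀' := h s₀ ⟨hs₀, le_rfl⟩
  by_cases hint : IntegrableOn (fun t => (s₀ - t) ^ (α - 1) * V t) (Ioo 0 s₀)
  swap
  · rw [integral_undef hint] at hs₀'
    nlinarith
  rcases hs₀.eq_or_lt with rfl | hpos
  · simp only [Ioo_self, setIntegral_empty, mul_zero, add_zero] at hs₀'
    nlinarith
  have hnn : ∀ s ∈ Icc 0 s₀, ∀ t ∈ Ioo 0 s, 0 ≤ (s - t) ^ (α - 1) * V t := fun s hs t ht =>
    mul_nonneg (Real.rpow_nonneg (by linarith [ht.2]) _) (hV t ⟨ht.1.le, ht.2.le.trans hs.2⟩)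
  have hofReal : ∀ s, ∀ t ∈ Ioo 0 s, ENNReal.ofReal ((s - t) ^ (α - 1) * V t) =
      ENNReal.ofReal ((s - t) ^ (α - 1)) * ENNReal.ofReal (V t) := fun s t ht =>
    ENNReal.ofReal_mul (Real.rpow_nonneg (by linarith [ht.2]) _)
  have hle : ∀ s ∈ Icc 0 s₀, ENNReal.ofReal (∫ t in Ioo 0 s, (s - t) ^ (α - 1) * V t) ≤
      ∫⁻ t in Ioo 0 s, ENNReal.ofReal ((s - t) ^ (α - 1)) * ENNReal.ofReal (V t) := by
    intro s hs
    by_cases hi : IntegrableOn (fun t => (s - t) ^ (α - 1) * V t) (Ioo 0 s)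
    · rw [ofReal_integral_eq_lintegral_ofReal hi, setLIntegral_congr_fun measurableSet_Ioo
        (hofReal s)]
      filter_upwards [ae_restrict_mem measurableSet_Ioo] with t ht using hnn s hs t ht
    · rw [integral_undef hi]
      simp
  have hmeas : AEMeasurable V (volume.restrict (Ioo 0 s₀)) := by
    have hm : AEMeasurable (fun t => ((s₀ - t) ^ (α - 1))⁻¹ * ((s₀ - t) ^ (α - 1) * V t))
        (volume.restrict (Ioo 0 s₀)) :=
      AEMeasurable.mul (by fun_prop) hint.aestronglyMeasurable.aemeasurable
    refine hm.congr ?_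
    filter_upwards [ae_restrict_mem measurableSet_Ioo] with t ht
    exact inv_mul_cancel_left₀ (Real.rpow_pos_of_pos (sub_pos.2 ht.2) _).ne' _
  have key := fractional_gronwall_lintegral hα ha hr hpos hmeas.ennreal_ofReal
    (by
      rw [← setLIntegral_congr_fun measurableSet_Ioo (hofReal s₀)]
      exact hint.lintegral_lt_top.ne)
    (fun s hs => by
      have hs' : s ∈ Icc 0 s₀ := ⟨hs.1.le, hs.2⟩
      refine (ENNReal.ofReal_le_ofReal (h s hs')).trans ?_
      rw [ENNReal.ofReal_add ha (mul_nonneg hr (setIntegral_nonneg measurableSet_Ioo (hnn s hs'))),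
        ENNReal.ofReal_mul hr]
      gcongr
      exact hle s hs')
  have hterm : ∀ m : ℕ, a * ((r * Real.Gamma α) ^ m * s₀ ^ (α * m) / Real.Gamma (α * m + 1)) =
      a * ((r * Real.Gamma α * s₀ ^ α) ^ m / Real.Gamma (α * m + 1)) := fun m => by
    rw [mul_pow _ (s₀ ^ α), Real.rpow_mul_natCast hs₀]
  have hterm_nonneg : ∀ m : ℕ,
      0 ≤ a * ((r * Real.Gamma α * s₀ ^ α) ^ m / Real.Gamma (α * m + 1)) := fun m =>
    mul_nonneg ha (div_nonneg (by positivity) (Real.Gamma_nonneg_of_nonneg (by positivity)))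
  simp_rw [hterm] at key
  rw [← ENNReal.ofReal_tsum_of_nonneg hterm_nonneg ((summable_mittagLeffler hα hx).mul_left a),
    tsum_mul_left] at key
  exact (ENNReal.ofReal_le_ofReal_iff (mul_nonneg ha (zero_le_one.trans hE))).1 key

/-- ψ-Gronwall inequality, Mittag-Leffler form: if `η` is in addition nondecreasing, then
`v(z) ≤ η(z) · E_α(ρ(z) Γ(α) (ψ(z) - ψ(0))^α)`. -/
theorem psi_gronwall_mittagLeffler (α b : ℝ) (hα : 0 < α) (hb : 0 < b)
    (v η ρ ψ ψ' : ℝ → ℝ)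
    (hv_int : MeasureTheory.IntegrableOn v (Set.Icc 0 b))
    (hη_int : MeasureTheory.IntegrableOn η (Set.Icc 0 b))
    (hv_nonneg : ∀ z ∈ Set.Icc 0 b, 0 ≤ v z)
    (hη_nonneg : ∀ z ∈ Set.Icc 0 b, 0 ≤ η z)
    (hη_mono : MonotoneOn η (Set.Icc 0 b))
    (hρ_cont : ContinuousOn ρ (Set.Icc 0 b))
    (hρ_nonneg : ∀ z ∈ Set.Icc 0 b, 0 ≤ ρ z)
    (hρ_mono : MonotoneOn ρ (Set.Icc 0 b))
    (hψ_cont : ContinuousOn ψ (Set.Icc 0 b))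
    (hψ_mono : StrictMonoOn ψ (Set.Icc 0 b))
    (hψ_deriv : ∀ z ∈ Set.Icc 0 b, HasDerivWithinAt ψ (ψ' z) (Set.Icc 0 b) z)
    (hψ'_ne : ∀ z ∈ Set.Icc 0 b, ψ' z ≠ 0)
    (hineq : ∀ z ∈ Set.Icc 0 b,
      v z ≤ η z + ρ z * ∫ κ in (0:ℝ)..z, ψ' κ * (ψ z - ψ κ) ^ (α - 1) * v κ) :
    ∀ z ∈ Set.Icc 0 b,
      v z ≤ η z * mittagLeffler α (ρ z * Real.Gamma α * (ψ z - ψ 0) ^ α) := by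
  intro z hz
  let φ : ℝ → ℝ := fun x => ψ x - ψ 0
  let g : ℝ → ℝ := Function.invFunOn φ (Icc 0 b)
  have h0 : (0 : ℝ) ∈ Icc 0 b := ⟨le_rfl, hb.le⟩
  have hφ_mono : StrictMonoOn φ (Icc 0 b) := fun x hx y hy hxy =>
    sub_lt_sub_right (hψ_mono hx hy hxy) _
  have hφ_cont : ContinuousOn φ (Icc 0 b) := hψ_cont.sub continuousOn_const
  have hφ0 : φ 0 = 0 := sub_self _
  have hgφ : ∀ x ∈ Icc 0 b, g (φ x) = x := fun x hx => hφ_mono.injOn.leftInvOn_invFunOn hx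
  have hψ'_nonneg : ∀ x ∈ Icc 0 b, 0 ≤ ψ' x := fun x hx => by
    rw [← (hψ_deriv x hx).derivWithin (uniqueDiffOn_Icc hb x hx)]
    exact hψ_mono.monotoneOn.derivWithin_nonneg
  have himg : ∀ x ∈ Icc 0 b, φ '' Icc 0 x = Icc 0 (φ x) := fun x hx => by
    have hsub : Icc 0 x ⊆ Icc 0 b := Icc_subset_Icc_right hx.2
    rw [(hφ_cont.mono hsub).image_Icc_of_monotoneOn hx.1 (hφ_mono.mono hsub).monotoneOn, hφ0]
  have himg' : ∀ x ∈ Icc 0 b, φ '' Ioo 0 x = Ioo 0 (φ x) := fun x hx => by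
    have hsub : Icc 0 x ⊆ Icc 0 b := Icc_subset_Icc_right hx.2
    rw [← Icc_sdiff_both, (hφ_mono.mono hsub).injOn.image_sdiff_subset
      (pair_subset (left_mem_Icc.2 hx.1) (right_mem_Icc.2 hx.1)), himg x hx, image_pair, hφ0,
      Icc_sdiff_both]
  have hcov : ∀ x ∈ Icc 0 b, ∫ t in Ioo 0 (φ x), (φ x - t) ^ (α - 1) * v (g t) =
      ∫ κ in (0:ℝ)..x, ψ' κ * (ψ x - ψ κ) ^ (α - 1) * v κ := fun x hx => by
    have hsub : Ioo 0 x ⊆ Icc 0 b := Ioo_subset_Icc_self.trans (Icc_subset_Icc_right hx.2)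
    rw [← himg' x hx, integral_image_eq_integral_abs_deriv_smul (f' := ψ') measurableSet_Ioo
      (fun κ hκ => ((hψ_deriv κ (hsub hκ)).sub_const _).mono hsub) (hφ_mono.mono hsub).injOn,
      intervalIntegral.integral_of_le hx.1, integral_Ioc_eq_integral_Ioo]
    refine setIntegral_congr_fun measurableSet_Ioo fun κ hκ => ?_
    simp only [smul_eq_mul]
    rw [hgφ κ (hsub hκ), abs_of_nonneg (hψ'_nonneg κ (hsub hκ)), ← mul_assoc]
    simp [φ]
  have hφz : 0 ≤ φ z := by
    rw [← hφ0]
    exact hφ_mono.monotoneOn h0 hz hz.1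
  have key := fractional_gronwall (V := fun t => v (g t)) hα (hη_nonneg z hz) (hρ_nonneg z hz) hφz
    (by
      rw [← himg z hz]
      rintro _ ⟨κ, hκ, rfl⟩
      have hκb : κ ∈ Icc 0 b := ⟨hκ.1, hκ.2.trans hz.2⟩
      rw [hgφ κ hκb]
      exact hv_nonneg κ hκb)
    (by
      rw [← himg z hz]
      rintro _ ⟨κ, hκ, rfl⟩
      have hκb : κ ∈ Icc 0 b := ⟨hκ.1, hκ.2.trans hz.2⟩
      rw [hcov κ hκb, hgφ κ hκb]
      refine (hineq κ hκb).trans (add_le_add (hη_mono hκb hz hκ.2)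
        (mul_le_mul_of_nonneg_right (hρ_mono hκb hz hκ.2) ?_))
      refine intervalIntegral.integral_nonneg hκ.1 fun t ht => ?_
      have htb : t ∈ Icc 0 b := ⟨ht.1, ht.2.trans hκb.2⟩
      exact mul_nonneg (mul_nonneg (hψ'_nonneg t htb) (Real.rpow_nonneg
        (sub_nonneg.2 (hψ_mono.monotoneOn htb hκb ht.2)) _)) (hv_nonneg t htb))
  rwa [hgφ z hz] at key
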